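/- Let q ≥ 1 be an integer, let (s_j)_{j=0}^∞ be a Stieltjes positive definite sequence of complex q×q matrices with associated matrix polynomials P_n, Q̂_n, and let P_n^{(1)}, Q̂_n^{(1)} be the corresponding polynomials built from the first Kátětov transform (s_j^{(1)})_{j=0}^∞. Then for every n ∈ ℕ: P_n^{(1)}(0) = s_0^{−1} Q̂_n(0) and Q̂_n^{(1)}(0) = −s_0 P_{n+1}(0). -/

import Mathlib

open Matrix
open scoped ComplexOrder

noncomputable section

/-- The space of complex `q × q` matrices. -/
abbrev Mq (q : ℕ) := Matrix (Fin q) (Fin q) ℂ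

/-- The space of complex `2q × 2q` matrices, written in `q × q` blocks. -/
abbrev M2q (q : ℕ) := Matrix (Fin q ⊕ Fin q) (Fin q ⊕ Fin q) ℂ

/-- Block Hankel matrix `H_n = (s_{j+k})_{j,k=0}^n`. -/
def Hmat (q : ℕ) (s : ℕ → Mq q) (n : ℕ) :
    Matrix (Fin (n + 1) × Fin q) (Fin (n + 1) × Fin q) ℂ :=
  Matrix.of fun p r => s (p.1.1 + r.1.1) p.2 r.2

/-- Block Hankel matrix `K_n = (s_{j+k+1})_{j,k=0}^n`. -/
def Kmat (q : ℕ) (s : ℕ → Mq q) (n : ℕ) :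
    Matrix (Fin (n + 1) × Fin q) (Fin (n + 1) × Fin q) ℂ :=
  Matrix.of fun p r => s (p.1.1 + r.1.1 + 1) p.2 r.2

/-- A sequence of complex `q × q` matrices is Stieltjes positive definite if all the
block Hankel matrices `H_n` and `K_n` are positive definite (in particular Hermitian). -/
def IsStieltjesPD (q : ℕ) (s : ℕ → Mq q) : Prop :=
  ∀ n : ℕ, (Hmat q s n).PosDef ∧ (Kmat q s n).PosDef

/-- Even Stieltjes parameters `𝔮_{2k}` (Schur complements `L_k`). -/
def qEven (q : ℕ) (s : ℕ → Mq q) : ℕ → Mq q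
  | 0 => s 0
  | k + 1 =>
      s (2 * (k + 1)) -
        (Matrix.of fun (a : Fin q) (r : Fin (k + 1) × Fin q) => s (k + 1 + r.1.1) a r.2) *
          (Hmat q s k)⁻¹ *
          (Matrix.of fun (p : Fin (k + 1) × Fin q) (b : Fin q) => s (k + 1 + p.1.1) p.2 b)

/-- Odd Stieltjes parameters `𝔮_{2k+1}` (Schur complements `Λ_k`). -/
def qOdd (q : ℕ) (s : ℕ → Mq q) : ℕ → Mq q
  | 0 => s 1
  | k + 1 =>
      s (2 * (k + 1) + 1) -
        (Matrix.of fun (a : Fin q) (r : Fin (k + 1) × Fin q) => s (k + 2 + r.1.1) a r.2) *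
          (Kmat q s k)⁻¹ *
          (Matrix.of fun (p : Fin (k + 1) × Fin q) (b : Fin q) => s (k + 2 + p.1.1) p.2 b)

/-- Stieltjes parametrization `𝔮_j`. -/
def qpar (q : ℕ) (s : ℕ → Mq q) (j : ℕ) : Mq q :=
  if j % 2 = 0 then qEven q s (j / 2) else qOdd q s (j / 2)

/-- Reciprocal sequence `s^♯`. -/
def reciprocal (q : ℕ) (s : ℕ → Mq q) : ℕ → Mq q
  | 0 => (s 0)⁻¹
  | j + 1 =>
      -(s 0)⁻¹ *
        ∑ l ∈ (Finset.range (j + 1)).attach, s (j + 1 - l.1) * reciprocal q s l.1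
  decreasing_by exact Finset.mem_range.mp l.2

/-- First Kátětov transform `s^{(1)}_j = −s_0 s_{j+1}^♯ s_0`. -/
def katetov1 (q : ℕ) (s : ℕ → Mq q) : ℕ → Mq q :=
  fun j => -(s 0) * reciprocal q s (j + 1) * s 0

/-- `ℓ`-th Kátětov transform (the `ℓ`-fold iterate of the first Kátětov transform). -/
def katetov (q : ℕ) (ℓ : ℕ) (s : ℕ → Mq q) : ℕ → Mq q :=
  (katetov1 q)^[ℓ] s

/-- `v_k = col(I_q, 0_{kq×q})`. -/
def vcol (q k : ℕ) : Matrix (Fin (k + 1) × Fin q) (Fin q) ℂ :=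
  Matrix.of fun p b => if p.1.1 = 0 ∧ p.2 = b then 1 else 0

/-- `y_{0,k} = col(s_0, …, s_k)`. -/
def ycol (q : ℕ) (s : ℕ → Mq q) (k : ℕ) : Matrix (Fin (k + 1) × Fin q) (Fin q) ℂ :=
  Matrix.of fun p b => s p.1.1 p.2 b

/-- Dyukarev–Stieltjes parameters `𝔐_k`. -/
def DSM (q : ℕ) (s : ℕ → Mq q) : ℕ → Mq q
  | 0 => (s 0)⁻¹
  | k + 1 =>
      (vcol q (k + 1))ᴴ * (Hmat q s (k + 1))⁻¹ * vcol q (k + 1) -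
        (vcol q k)ᴴ * (Hmat q s k)⁻¹ * vcol q k

/-- Dyukarev–Stieltjes parameters `𝔏_k`. -/
def DSL (q : ℕ) (s : ℕ → Mq q) : ℕ → Mq q
  | 0 => s 0 * (s 1)⁻¹ * s 0
  | k + 1 =>
      (ycol q s (k + 1))ᴴ * (Kmat q s (k + 1))⁻¹ * ycol q s (k + 1) -
        (ycol q s k)ᴴ * (Kmat q s k)⁻¹ * ycol q s k

/-- Ordered product `A_0 A_1 ⋯ A_n`. -/
def oprod {α : Type*} [Monoid α] (f : ℕ → α) (n : ℕ) : α :=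
  ((List.range (n + 1)).map f).prod

/-- Block shift `T_n = (δ_{j,k+1} I_q)_{j,k=0}^n`. -/
def Tmat (q n : ℕ) : Matrix (Fin (n + 1) × Fin q) (Fin (n + 1) × Fin q) ℂ :=
  Matrix.of fun p r => if p.1.1 = r.1.1 + 1 ∧ p.2 = r.2 then 1 else 0

/-- `R_n(z) = (I_{(n+1)q} − z T_n)⁻¹`. -/
def Rmat (q n : ℕ) (z : ℂ) : Matrix (Fin (n + 1) × Fin q) (Fin (n + 1) × Fin q) ℂ :=
  (1 - z • Tmat q n)⁻¹

/-- `u_0 = 0`, `u_n = col(0_{q×q}, −y_{0,n−1})`. -/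
def ucol (q : ℕ) (s : ℕ → Mq q) (n : ℕ) : Matrix (Fin (n + 1) × Fin q) (Fin q) ℂ :=
  Matrix.of fun p b => if p.1.1 = 0 then 0 else -(s (p.1.1 - 1) p.2 b)

/-- `col(−H_n⁻¹ y_{n+1,2n+1}, I_q)` of size `(n+2)q × q`. -/
def colH (q : ℕ) (s : ℕ → Mq q) (n : ℕ) : Matrix (Fin (n + 2) × Fin q) (Fin q) ℂ :=
  Matrix.of fun p b =>
    if h : p.1.1 < n + 1 then
      (-((Hmat q s n)⁻¹ *
          Matrix.of fun (r : Fin (n + 1) × Fin q) (c : Fin q) => s (n + 1 + r.1.1) r.2 c))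
        (⟨p.1.1, h⟩, p.2) b
    else if p.2 = b then 1 else 0

/-- `col(−K_n⁻¹ y_{n+2,2n+2}, I_q)` of size `(n+2)q × q`. -/
def colK (q : ℕ) (s : ℕ → Mq q) (n : ℕ) : Matrix (Fin (n + 2) × Fin q) (Fin q) ℂ :=
  Matrix.of fun p b =>
    if h : p.1.1 < n + 1 then
      (-((Kmat q s n)⁻¹ *
          Matrix.of fun (r : Fin (n + 1) × Fin q) (c : Fin q) => s (n + 2 + r.1.1) r.2 c))
        (⟨p.1.1, h⟩, p.2) b
    else if p.2 = b then 1 else 0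

/-- `z_{0,n} = row(s_0, …, s_n)`. -/
def zrow (q : ℕ) (s : ℕ → Mq q) (n : ℕ) : Matrix (Fin q) (Fin (n + 1) × Fin q) ℂ :=
  Matrix.of fun a r => s r.1.1 a r.2

/-- Orthogonal matrix polynomials `P_n`. -/
def Ppoly (q : ℕ) (s : ℕ → Mq q) : ℕ → ℂ → Mq q
  | 0, _ => 1
  | n + 1, z => (vcol q (n + 1))ᴴ * (Rmat q (n + 1) (starRingEnd ℂ z))ᴴ * colH q s n

/-- Second kind matrix polynomials `Q_n`. -/
def Qpoly (q : ℕ) (s : ℕ → Mq q) : ℕ → ℂ → Mq q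
  | 0, _ => 0
  | n + 1, z => -((ucol q s (n + 1))ᴴ * (Rmat q (n + 1) (starRingEnd ℂ z))ᴴ * colH q s n)

/-- Matrix polynomials `P̂_n`. -/
def Phat (q : ℕ) (s : ℕ → Mq q) : ℕ → ℂ → Mq q
  | 0, _ => 1
  | n + 1, z => (vcol q (n + 1))ᴴ * (Rmat q (n + 1) (starRingEnd ℂ z))ᴴ * colK q s n

/-- Matrix polynomials `Q̂_n`. -/
def Qhat (q : ℕ) (s : ℕ → Mq q) : ℕ → ℂ → Mq q
  | 0, _ => s 0
  | n + 1, z => zrow q s (n + 1) * (Rmat q (n + 1) (starRingEnd ℂ z))ᴴ * colK q s n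

/-- `α_n(z)`. -/
def alphaP (q : ℕ) (s : ℕ → Mq q) (n : ℕ) (z : ℂ) : Mq q :=
  1 - z • ((ucol q s n)ᴴ * (Rmat q n (starRingEnd ℂ z))ᴴ * (Hmat q s n)⁻¹ * vcol q n)

/-- `γ_n(z)`. -/
def gammaP (q : ℕ) (s : ℕ → Mq q) (n : ℕ) (z : ℂ) : Mq q :=
  -(z • ((vcol q n)ᴴ * (Rmat q n (starRingEnd ℂ z))ᴴ * (Hmat q s n)⁻¹ * vcol q n))

/-- `β_n(z)`. -/
def betaP (q : ℕ) (s : ℕ → Mq q) : ℕ → ℂ → Mq q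
  | 0, _ => 0
  | n + 1, z => (ycol q s n)ᴴ * (Rmat q n (starRingEnd ℂ z))ᴴ * (Kmat q s n)⁻¹ * ycol q s n

/-- `δ_n(z)`. -/
def deltaP (q : ℕ) (s : ℕ → Mq q) : ℕ → ℂ → Mq q
  | 0, _ => 1
  | n + 1, z =>
      1 + z • ((vcol q n)ᴴ * (Rmat q n (starRingEnd ℂ z))ᴴ * (Kmat q s n)⁻¹ * ycol q s n)

/-- The resolvent matrices `U_m(z)`. -/
def Umat (q : ℕ) (s : ℕ → Mq q) (m : ℕ) (z : ℂ) : M2q q :=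
  if m % 2 = 0 then
    Matrix.fromBlocks (alphaP q s (m / 2) z) (betaP q s (m / 2) z)
      (gammaP q s (m / 2) z) (deltaP q s (m / 2) z)
  else
    Matrix.fromBlocks (alphaP q s (m / 2) z) (betaP q s (m / 2 + 1) z)
      (gammaP q s (m / 2) z) (deltaP q s (m / 2 + 1) z)

/-- `𝕄_k(z) = [[I, 0], [−z𝔐_k, I]]`. -/
def MM (q : ℕ) (s : ℕ → Mq q) (k : ℕ) (z : ℂ) : M2q q :=
  Matrix.fromBlocks 1 0 (-(z • DSM q s k)) 1

/-- `𝕃_k = [[I, 𝔏_k], [0, I]]`. -/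
def LL (q : ℕ) (s : ℕ → Mq q) (k : ℕ) : M2q q :=
  Matrix.fromBlocks 1 (DSL q s k) 0 1

/-- `𝒫_n = diag([P_n(0)]^{−*}, P_n(0))`. -/
def PPmat (q : ℕ) (s : ℕ → Mq q) (n : ℕ) : M2q q :=
  Matrix.fromBlocks (((Ppoly q s n 0)⁻¹)ᴴ) 0 0 (Ppoly q s n 0)

/-- `𝐐_n(z) = [[0, Q̂_n(0)], [−z[Q̂_n(0)]^{−*}, 0]]`. -/
def QQgen (q : ℕ) (s : ℕ → Mq q) (n : ℕ) (z : ℂ) : M2q q :=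
  Matrix.fromBlocks 0 (Qhat q s n 0) (-(z • ((Qhat q s n 0)⁻¹)ᴴ)) 0

/-- `𝐐_0^{(ℓ)}(z) = [[0, s_0^{(ℓ)}], [−z(s_0^{(ℓ)})⁻¹, 0]]`. -/
def QQ0 (q : ℕ) (s : ℕ → Mq q) (ℓ : ℕ) (z : ℂ) : M2q q :=
  Matrix.fromBlocks 0 (katetov q ℓ s 0) (-(z • (katetov q ℓ s 0)⁻¹)) 0

/-- `𝒬_m(z) = 𝐐_0^{(0)}(z) ⋯ 𝐐_0^{(m)}(z)`. -/
def Qprod (q : ℕ) (s : ℕ → Mq q) (m : ℕ) (z : ℂ) : M2q q :=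
  oprod (fun ℓ => QQ0 q s ℓ z) m

open Finset in
lemma aux_core {R : Type*} [Ring R] (t s p : ℕ → R) (c : R)
    (hA : ∀ j, ∑ i ∈ range (j + 1), t i * c * s (j - i) = s (j + 1)) (n j : ℕ) :
    ∑ k ∈ range (n + 1), t (j + k) *
        (c * ∑ m ∈ range (n + 1), if k ≤ m then s (m - k) * p m else 0) =
      ∑ m ∈ range (n + 1), s (j + m + 1) * p m -
        ∑ i ∈ range j, t i * c * ∑ m ∈ range (n + 1), s (j - i + m) * p m := by
  simp only [Finset.mul_sum]
  rw [Finset.sum_comm, Finset.sum_comm (s := range j), ← Finset.sum_sub_distrib]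
  refine Finset.sum_congr rfl fun m hm => ?_
  have hm' : m < n + 1 := Finset.mem_range.mp hm
  rw [← hA (j + m), add_assoc j m 1, Finset.sum_range_add _ j (m + 1), add_mul, Finset.sum_mul, Finset.sum_mul]
  have h1 : ∑ i ∈ range j, t i * c * s (j + m - i) * p m
      = ∑ i ∈ range j, t i * c * (s (j - i + m) * p m) := by
    refine Finset.sum_congr rfl fun i hi => ?_
    have := Finset.mem_range.mp hi
    rw [show j + m - i = j - i + m by omega, mul_assoc]
  rw [h1, add_sub_cancel_left]
  have h2 : range (n + 1) = range ((m + 1) + (n - m)) := by congr 1; omega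
  rw [h2, Finset.sum_range_add, Finset.sum_eq_zero (s := range (n - m)), add_zero]
  · refine Finset.sum_congr rfl fun k hk => ?_
    have := Finset.mem_range.mp hk
    rw [if_pos (by omega), show j + m - (j + k) = m - k by omega]
    simp only [mul_assoc]
  · intro k _
    rw [if_neg (by omega)]
    simp

open Finset in
lemma aux_inv {R : Type*} [Ring R] (s r w : ℕ → R) (s0 c : R) (hc : c * s0 = 1)
    (hB : ∀ j, ∑ i ∈ range (j + 1), s i * r (j - i) = if j = 0 then 1 else 0)
    (n k : ℕ) (hk : k ≤ n) :
    c * ∑ m ∈ range (n + 1), (if k ≤ m then s (m - k) *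
      (∑ l ∈ range (n + 1), if m ≤ l then r (l - m) * (s0 * w l) else 0) else 0) = w k := by
  have h1 : ∑ m ∈ range (n + 1), (if k ≤ m then s (m - k) *
      (∑ l ∈ range (n + 1), if m ≤ l then r (l - m) * (s0 * w l) else 0) else 0)
      = ∑ l ∈ range (n + 1), if k = l then s0 * w l else 0 := by
    simp only [Finset.mul_sum]
    have : ∀ m ∈ range (n+1), (if k ≤ m then ∑ l ∈ range (n+1), s (m - k) *
        (if m ≤ l then r (l - m) * (s0 * w l) else 0) else 0)
        = ∑ l ∈ range (n+1), (if k ≤ m ∧ m ≤ l then s (m - k) * r (l - m) else 0) * (s0 * w l) := by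
      intro m _
      by_cases h : k ≤ m
      · simp only [h, if_true, true_and]
        refine Finset.sum_congr rfl fun l _ => ?_
        split_ifs <;> simp [mul_assoc]
      · simp [h]
    rw [Finset.sum_congr rfl this, Finset.sum_comm]
    refine Finset.sum_congr rfl fun l hl => ?_
    have hl' := Finset.mem_range.mp hl
    rw [← Finset.sum_mul]
    by_cases hkl : k ≤ l
    · have h3 : ∑ m ∈ range (n+1), (if k ≤ m ∧ m ≤ l then s (m - k) * r (l - m) else 0)
          = ∑ i ∈ range (l - k + 1), s i * r (l - k - i) := by
        rw [show n + 1 = k + ((l - k + 1) + (n - l)) by omega, Finset.sum_range_add,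
          Finset.sum_range_add, Finset.sum_eq_zero (s := range k), zero_add,
          Finset.sum_eq_zero (s := range (n - l)), add_zero]
        · refine Finset.sum_congr rfl fun i hi => ?_
          have := Finset.mem_range.mp hi
          rw [if_pos (by omega), show k + i - k = i by omega, show l - (k + i) = l - k - i by omega]
        · intro i _
          rw [if_neg (by omega)]
        · intro i hi
          have := Finset.mem_range.mp hi
          rw [if_neg (by omega)]
      rw [h3, hB]
      by_cases h : k = l
      · simp [h]
      · rw [if_neg (by omega), if_neg h, zero_mul]
    · rw [if_neg (by omega), Finset.sum_eq_zero, zero_mul]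
      intro m _
      rw [if_neg (by omega)]
  rw [h1, Finset.sum_ite_eq, if_pos (Finset.mem_range.mpr (by omega)), ← mul_assoc, hc, one_mul]

def HInj {R : Type*} [Ring R] (f : ℕ → R) (n : ℕ) : Prop :=
  ∀ X : ℕ → R, (∀ j ≤ n, ∑ k ∈ Finset.range (n + 1), f (j + k) * X k = 0) → ∀ k ≤ n, X k = 0

open Finset in
lemma aux_injH {R : Type*} [Ring R] (t s r : ℕ → R) (s0 c : R) (hc : c * s0 = 1)
    (hA : ∀ j, ∑ i ∈ range (j + 1), t i * c * s (j - i) = s (j + 1))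
    (hB : ∀ j, ∑ i ∈ range (j + 1), s i * r (j - i) = if j = 0 then 1 else 0)
    (n : ℕ) (hK : HInj (fun j => s (j + 1)) n) : HInj t n := by
  intro w hw
  set p : ℕ → R := fun m => ∑ l ∈ range (n + 1), if m ≤ l then r (l - m) * (s0 * w l) else 0 with hp
  have hwp : ∀ k ≤ n, c * ∑ m ∈ range (n + 1), (if k ≤ m then s (m - k) * p m else 0) = w k :=
    fun k hk => aux_inv s r w s0 c hc hB n k hk
  have hz : ∀ j, j ≤ n → ∑ m ∈ range (n + 1), s (j + m + 1) * p m = 0 := by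
    intro j
    induction j using Nat.strong_induction_on with
    | _ j ih =>
      intro hj
      have h1 := aux_core t s p c hA n j
      rw [Finset.sum_eq_zero (s := range j), sub_zero] at h1
      · rw [← h1]
        refine Eq.trans ?_ (hw j hj)
        refine Finset.sum_congr rfl fun k hk => ?_
        rw [hwp k (by have := Finset.mem_range.mp hk; omega)]
      · intro i hi
        have hi' := Finset.mem_range.mp hi
        have := ih (j - i - 1) (by omega) (by omega)
        by_cases h0 : i = 0
        all_goals
          rw [← mul_zero (t i * c), ← ih (j - i - 1) (by omega) (by omega)]
          congr 1
          refine Finset.sum_congr rfl fun m _ => ?_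
          rw [show j - i - 1 + m + 1 = j - i + m by omega]
  have hp0 := hK p hz
  intro k hk
  rw [← hwp k hk, Finset.sum_eq_zero, mul_zero]
  intro m hm
  rw [hp0 m (by have := Finset.mem_range.mp hm; omega)]
  simp

open Finset in
lemma aux_coreK {R : Type*} [Ring R] (t s p : ℕ → R) (c : R)
    (hA : ∀ j, ∑ i ∈ range (j + 1), t i * c * s (j - i) = s (j + 1)) (n j : ℕ) :
    ∑ k ∈ range (n + 1), t (j + k + 1) *
        (c * ∑ m ∈ range (n + 1), if k ≤ m then s (m - k) * p (m + 1) else 0) =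
      ∑ m ∈ range (n + 2), s (j + 1 + m) * p m -
        ∑ i ∈ range (j + 1), t i * c * ∑ m ∈ range (n + 2), s (j - i + m) * p m := by
  have h1 := aux_core t s (fun m => p (m + 1)) c hA n (j + 1)
  have h2 : ∀ k, j + 1 + k = j + k + 1 := fun k => by omega
  simp only [h2] at h1
  rw [h1]
  have h3 : ∀ i ∈ range (j + 1), t i * c * ∑ m ∈ range (n + 1), s (j + 1 - i + m) * p (m + 1)
      = t i * c * ∑ m ∈ range (n + 2), s (j - i + m) * p m - t i * c * s (j - i) * p 0 := by
    intro i hi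
    have hi' := Finset.mem_range.mp hi
    rw [Finset.sum_range_succ' _ (n + 1), mul_add, add_zero, mul_assoc (t i * c) (s _) (p 0),
      add_sub_cancel_right]
    congr 1
    refine Finset.sum_congr rfl fun m _ => ?_
    rw [show j + 1 - i + m = j - i + (m + 1) by omega]
  rw [Finset.sum_congr rfl h3, Finset.sum_sub_distrib, ← Finset.sum_mul, hA,
    Finset.sum_range_succ' (fun m => s (j + 1 + m) * p m) (n + 1)]
  have h4 : ∀ m, j + 1 + (m + 1) = j + m + 1 + 1 := fun m => by omega
  simp only [add_zero, h4]
  abel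

open Finset in
lemma aux_injK {R : Type*} [Ring R] (t s r : ℕ → R) (s0 c : R) (hc : c * s0 = 1)
    (hc' : s0 * c = 1) (hs0 : s 0 = s0)
    (hA : ∀ j, ∑ i ∈ range (j + 1), t i * c * s (j - i) = s (j + 1))
    (hB : ∀ j, ∑ i ∈ range (j + 1), s i * r (j - i) = if j = 0 then 1 else 0)
    (n : ℕ) (hH : HInj s (n + 1)) : HInj (fun j => t (j + 1)) n := by
  intro w hw
  set p' : ℕ → R := fun m => ∑ l ∈ range (n + 1), if m ≤ l then r (l - m) * (s0 * w l) else 0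
    with hp'
  have hwp : ∀ k ≤ n, c * ∑ m ∈ range (n + 1), (if k ≤ m then s (m - k) * p' m else 0) = w k :=
    fun k hk => aux_inv s r w s0 c hc hB n k hk
  set p : ℕ → R := fun m => match m with
    | 0 => -(c * ∑ m ∈ range (n + 1), s (m + 1) * p' m)
    | m + 1 => p' m with hp
  have hz : ∀ j, j ≤ n + 1 → ∑ m ∈ range (n + 2), s (j + m) * p m = 0 := by
    intro j
    induction j using Nat.strong_induction_on with
    | _ j ih =>
      intro hj
      cases j with
      | zero =>
        rw [Finset.sum_range_succ' _ (n + 1)]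
        simp only [hp, zero_add, hs0]
        rw [mul_neg, ← mul_assoc, hc', one_mul, add_neg_cancel]
      | succ j =>
        have h1 := aux_coreK t s p c hA n j
        rw [Finset.sum_eq_zero (s := range (j + 1)), sub_zero] at h1
        · rw [← h1]
          refine Eq.trans ?_ (hw j (by omega))
          refine Finset.sum_congr rfl fun k hk => ?_
          rw [← hwp k (by have := Finset.mem_range.mp hk; omega)]
        · intro i hi
          rw [ih (j - i) (by omega) (by omega), mul_zero]
  have hp0 := hH p hz
  intro k hk
  rw [← hwp k hk, Finset.sum_eq_zero, mul_zero]
  intro m hm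
  have : p' m = 0 := hp0 (m + 1) (by have := Finset.mem_range.mp hm; omega)
  rw [this]
  simp

open Finset in
lemma aux_unique {R : Type*} [Ring R] (f X Y : ℕ → R) (n : ℕ) (hf : HInj f n)
    (hX : ∀ j ≤ n, ∑ k ∈ range (n + 2), f (j + k) * X k = 0)
    (hY : ∀ j ≤ n, ∑ k ∈ range (n + 2), f (j + k) * Y k = 0)
    (hXY : X (n + 1) = Y (n + 1)) : ∀ k ≤ n + 1, X k = Y k := by
  intro k hk
  by_cases h : k = n + 1
  · rw [h, hXY]
  · rw [← sub_eq_zero]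
    refine hf (fun k => X k - Y k) (fun j hj => ?_) k (by omega)
    have h1 := hX j hj
    have h2 := hY j hj
    rw [Finset.sum_range_succ] at h1 h2
    simp only [mul_sub, Finset.sum_sub_distrib]
    rw [eq_neg_of_add_eq_zero_left h1, eq_neg_of_add_eq_zero_left h2, hXY, sub_self]

lemma Kmat_eq (q : ℕ) (s : ℕ → Mq q) (n : ℕ) : Kmat q s n = Hmat q (fun j => s (j + 1)) n := rfl

lemma colK_eq (q : ℕ) (s : ℕ → Mq q) (n : ℕ) : colK q s n = colH q (fun j => s (j + 1)) n := by
  unfold colK colH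
  rw [Kmat_eq]
  have : ∀ r, n + 2 + r = n + 1 + r + 1 := fun r => by omega
  simp only [this]

lemma HInj_of_posDef (q : ℕ) (f : ℕ → Mq q) (n : ℕ) (h : IsUnit (Hmat q f n)) : HInj f n := by
  intro X hX k hk
  set Y : Matrix (Fin (n + 1) × Fin q) (Fin q) ℂ := Matrix.of fun p b => X p.1.1 p.2 b with hY
  have h1 : Hmat q f n * Y = 0 := by
    ext p b
    have := congrFun (congrFun (hX p.1.1 (by omega)) p.2) b
    rw [Finset.sum_range, Matrix.sum_apply] at this
    rw [Matrix.mul_apply, Fintype.sum_prod_type]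
    simpa [Matrix.mul_apply, Hmat, hY] using this
  have h2 : Y = 0 := by
    have hd := (Matrix.isUnit_iff_isUnit_det _).mp h
    rw [← Matrix.nonsing_inv_mul_cancel_left (A := Hmat q f n) Y hd, h1, Matrix.mul_zero]
  ext a b
  exact congrFun (congrFun h2 (⟨k, by omega⟩, a)) b

lemma isUnit_of_HInj (q : ℕ) (f : ℕ → Mq q) (n : ℕ) (h : HInj f n) : IsUnit (Hmat q f n) := by
  rw [← Matrix.mulVec_injective_iff_isUnit]
  rw [← Matrix.coe_mulVecLin, ← LinearMap.ker_eq_bot, LinearMap.ker_eq_bot']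
  intro v hv
  have key := h (fun k => Matrix.of fun a _ => if hk : k < n + 1 then v (⟨k, hk⟩, a) else 0) ?_
  · ext p
    have := congrFun (congrFun (key p.1.1 (by omega)) p.2) p.2
    simpa [Nat.lt_succ_iff.mp p.1.2] using this
  · intro j hj
    ext a b
    have := congrFun hv (⟨j, by omega⟩, a)
    rw [Finset.sum_range, Matrix.sum_apply]
    simp only [Matrix.mulVecLin_apply, Matrix.mulVec, dotProduct, Fintype.sum_prod_type] at this
    simpa [Matrix.mul_apply, Hmat, Nat.lt_succ_iff.mp (Fin.is_lt _)] using this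

/-- Block coefficients of `colH`. -/
def cf (q : ℕ) (f : ℕ → Mq q) (n k : ℕ) : Mq q :=
  Matrix.of fun a b => if h : k < n + 2 then colH q f n (⟨k, h⟩, a) b else 0

lemma cf_top (q : ℕ) (f : ℕ → Mq q) (n : ℕ) : cf q f n (n + 1) = 1 := by
  ext a b
  simp [cf, colH, Matrix.one_apply]

lemma cf_eqn (q : ℕ) (f : ℕ → Mq q) (n : ℕ) (h : IsUnit (Hmat q f n)) :
    ∀ j ≤ n, ∑ k ∈ Finset.range (n + 2), f (j + k) * cf q f n k = 0 := by
  intro j hj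
  have hd := (Matrix.isUnit_iff_isUnit_det _).mp h
  rw [Finset.sum_range_succ, cf_top, mul_one, add_eq_zero_iff_eq_neg, Finset.sum_range]
  ext a b
  set Z : Matrix (Fin (n + 1) × Fin q) (Fin q) ℂ :=
    Matrix.of fun (r : Fin (n + 1) × Fin q) (c : Fin q) => f (n + 1 + r.1.1) r.2 c with hZ
  have h1 : Hmat q f n * (-((Hmat q f n)⁻¹ * Z)) = -Z := by
    rw [Matrix.mul_neg, Matrix.mul_nonsing_inv_cancel_left _ _ hd]
  have h2 := congrFun (congrFun h1 (⟨j, by omega⟩, a)) b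
  rw [Matrix.mul_apply, Fintype.sum_prod_type] at h2
  rw [Matrix.sum_apply]
  have h3 : (-Z) (⟨j, by omega⟩, a) b = (-f (j + (n + 1))) a b := by
    simp [hZ, add_comm]
  rw [← h3, ← h2]
  refine Finset.sum_congr rfl fun k _ => ?_
  rw [Matrix.mul_apply]
  refine Finset.sum_congr rfl fun c _ => ?_
  have hk : k.1 < n + 2 := by omega
  have hk' : k.1 ≤ n := by omega
  simp [cf, colH, Hmat, hZ, hk, hk']

lemma Rmat_zero (q n : ℕ) : (Rmat q n (starRingEnd ℂ 0))ᴴ = 1 := by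
  simp [Rmat]

lemma Ppoly_zero (q : ℕ) (s : ℕ → Mq q) (n : ℕ) : Ppoly q s (n + 1) 0 = cf q s n 0 := by
  rw [Ppoly, Rmat_zero, Matrix.mul_one]
  ext a b
  rw [Matrix.mul_apply, Fintype.sum_prod_type, Fin.sum_univ_succ]
  simp [vcol, cf, ite_and]

lemma Qhat_zero (q : ℕ) (s : ℕ → Mq q) (n : ℕ) :
    Qhat q s (n + 1) 0 = ∑ k ∈ Finset.range (n + 2), s k * cf q (fun j => s (j + 1)) n k := by
  rw [Qhat, Rmat_zero, Matrix.mul_one, colK_eq, Finset.sum_range]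
  ext a b
  rw [Matrix.mul_apply, Fintype.sum_prod_type, Matrix.sum_apply]
  refine Finset.sum_congr rfl fun k _ => ?_
  rw [Matrix.mul_apply]
  simp [zrow, cf]

lemma recip_right (q : ℕ) (s : ℕ → Mq q) (h : s 0 * (s 0)⁻¹ = 1) :
    PowerSeries.mk s * PowerSeries.mk (reciprocal q s) = 1 := by
  ext1 j
  rw [PowerSeries.coeff_mul, Finset.Nat.sum_antidiagonal_eq_sum_range_succ_mk]
  simp only [PowerSeries.coeff_mk, PowerSeries.coeff_one]
  cases j with
  | zero => simp [reciprocal, h]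
  | succ j =>
    rw [if_neg (by omega), ← Finset.sum_range_reflect, Finset.sum_range_succ]
    have h1 : reciprocal q s (j + 1) =
        -(s 0)⁻¹ * ∑ l ∈ Finset.range (j + 1), s (j + 1 - l) * reciprocal q s l := by
      rw [reciprocal, Finset.sum_attach (Finset.range (j + 1))
        (fun l => s (j + 1 - l) * reciprocal q s l)]
    have h2 : ∀ l ∈ Finset.range (j + 1), s (j + 1 + 1 - 1 - l) *
        reciprocal q s (j + 1 - (j + 1 + 1 - 1 - l)) = s (j + 1 - l) * reciprocal q s l := by
      intro l hl
      have := Finset.mem_range.mp hl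
      rw [show j + 1 + 1 - 1 - l = j + 1 - l by omega, show j + 1 - (j + 1 - l) = l by omega]
    rw [Finset.sum_congr rfl h2]
    simp only [show j + 1 + 1 - 1 - (j + 1) = 0 by omega, Nat.sub_zero]
    rw [h1, ← mul_assoc, mul_neg, h, neg_one_mul, add_neg_cancel]

lemma recip_left (q : ℕ) (s : ℕ → Mq q) (h : s 0 * (s 0)⁻¹ = 1) (h' : (s 0)⁻¹ * s 0 = 1) :
    PowerSeries.mk (reciprocal q s) * PowerSeries.mk s = 1 := by
  have h0 : reciprocal q s 0 = (s 0)⁻¹ := by rw [reciprocal]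
  have hu : IsUnit (s 0).det := (Matrix.isUnit_iff_isUnit_det _).mp ⟨⟨s 0, (s 0)⁻¹, h, h'⟩, rfl⟩
  have h1 := recip_right q s h
  have h2 := recip_right q (reciprocal q s) (by
    rw [h0, Matrix.nonsing_inv_nonsing_inv _ hu, h'])
  have h3 := left_inv_eq_right_inv h1 h2
  rw [h3]
  exact h2

lemma katetov_conv (q : ℕ) (s : ℕ → Mq q) (h : s 0 * (s 0)⁻¹ = 1) (h' : (s 0)⁻¹ * s 0 = 1)
    (j : ℕ) : ∑ i ∈ Finset.range (j + 1), katetov q 1 s i * (s 0)⁻¹ * s (j - i) = s (j + 1) := by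
  have h1 := congrArg (PowerSeries.coeff (j + 1)) (recip_left q s h h')
  rw [PowerSeries.coeff_mul, Finset.Nat.sum_antidiagonal_eq_sum_range_succ_mk] at h1
  simp only [PowerSeries.coeff_mk, PowerSeries.coeff_one] at h1
  rw [if_neg (by omega), Finset.sum_range_succ'] at h1
  have h0 : reciprocal q s 0 = (s 0)⁻¹ := by rw [reciprocal]
  have h2 : ∀ i ∈ Finset.range (j + 1), katetov q 1 s i * (s 0)⁻¹ * s (j - i)
      = -(s 0) * (reciprocal q s (i + 1) * s (j + 1 - (i + 1))) := by
    intro i _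
    have : katetov q 1 s i = -(s 0) * reciprocal q s (i + 1) * s 0 := rfl
    rw [this, mul_assoc _ (s 0), h, mul_one, mul_assoc, Nat.add_sub_add_right]
  rw [Finset.sum_congr rfl h2, ← Finset.mul_sum, eq_neg_of_add_eq_zero_left h1, h0, neg_mul_neg,
    ← mul_assoc, h, one_mul, Nat.sub_zero]

/-- `P_n^{(1)}(0) = s_0⁻¹ Q̂_n(0)` and `Q̂_n^{(1)}(0) = −s_0 P_{n+1}(0)`. -/
theorem stmt17 (q : ℕ) (hq : 1 ≤ q) (s : ℕ → Mq q) (hs : IsStieltjesPD q s) (n : ℕ) (hn : 1 ≤ n) :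
    Ppoly q (katetov q 1 s) n 0 = (s 0)⁻¹ * Qhat q s n 0 ∧
      Qhat q (katetov q 1 s) n 0 = -(s 0 * Ppoly q s (n + 1) 0) := by
  have hu0 : ∀ m, IsUnit (Hmat q s m) := fun m => (hs m).1.isUnit
  have hu1 : ∀ m, IsUnit (Hmat q (fun j => s (j + 1)) m) := fun m => (hs m).2.isUnit
  have hd : IsUnit (s 0) := by
    rw [← Matrix.mulVec_injective_iff_isUnit, ← Matrix.coe_mulVecLin, ← LinearMap.ker_eq_bot,
      LinearMap.ker_eq_bot']
    intro v hv
    have key := HInj_of_posDef q s 0 (hu0 0) (fun _ => Matrix.of fun a _ => v a) (by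
      intro j hj
      obtain rfl : j = 0 := by omega
      ext a b
      have := congrFun hv a
      simpa [Matrix.mul_apply, Matrix.mulVec, dotProduct] using this) 0 le_rfl
    ext a
    exact congrFun (congrFun key a) a
  have hd' := (Matrix.isUnit_iff_isUnit_det _).mp hd
  have h : s 0 * (s 0)⁻¹ = 1 := Matrix.mul_nonsing_inv _ hd'
  have h' : (s 0)⁻¹ * s 0 = 1 := Matrix.nonsing_inv_mul _ hd'
  have hA := katetov_conv q s h h'
  have hB : ∀ j, ∑ i ∈ Finset.range (j + 1), s i * reciprocal q s (j - i)
      = if j = 0 then 1 else 0 := by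
    intro j
    have h1 := congrArg (PowerSeries.coeff j) (recip_right q s h)
    rw [PowerSeries.coeff_mul, Finset.Nat.sum_antidiagonal_eq_sum_range_succ_mk] at h1
    simpa only [PowerSeries.coeff_mk, PowerSeries.coeff_one] using h1
  set t := katetov q 1 s with ht
  obtain ⟨n, rfl⟩ : ∃ m, n = m + 1 := ⟨n - 1, by omega⟩
  have iH : HInj t n := aux_injH t s _ (s 0) _ h' hA hB n (HInj_of_posDef q _ n (hu1 n))
  have iK : HInj (fun j => t (j + 1)) n :=
    aux_injK t s _ (s 0) _ h' h rfl hA hB n (HInj_of_posDef q s (n + 1) (hu0 (n + 1)))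
  constructor
  · rw [Ppoly_zero, Qhat_zero]
    set p := cf q (fun j => s (j + 1)) n with hp
    have hpe := cf_eqn q _ n (hu1 n)
    have := aux_unique t (cf q t n)
      (fun k => (s 0)⁻¹ * ∑ m ∈ Finset.range (n + 1 + 1), if k ≤ m then s (m - k) * p m else 0)
      n iH (cf_eqn q t n (isUnit_of_HInj q t n iH)) (by
        intro j hj
        have h1 := aux_core t s p _ hA (n + 1) j
        rw [hpe j hj, Finset.sum_eq_zero (s := Finset.range j), sub_zero] at h1
        · exact h1
        · intro i hi
          have hi' := Finset.mem_range.mp hi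
          rw [← mul_zero (t i * (s 0)⁻¹), ← hpe (j - i - 1) (by omega)]
          congr 1
          refine Finset.sum_congr rfl fun m _ => ?_
          rw [show j - i - 1 + m + 1 = j - i + m by omega]) (by
        rw [cf_top, Finset.sum_range_succ, Finset.sum_eq_zero, zero_add, if_pos le_rfl,
          Nat.sub_self, hp, cf_top, mul_one, h']
        intro m hm
        have := Finset.mem_range.mp hm
        rw [if_neg (by omega)]) 0 (by omega)
    simpa using this
  · rw [Ppoly_zero, Qhat_zero]
    set p := cf q s (n + 1) with hp
    have hpe := cf_eqn q s (n + 1) (hu0 (n + 1))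
    have hcf := cf_eqn q (fun j => t (j + 1)) n (isUnit_of_HInj q (fun j => t (j + 1)) n iK)
    have key := aux_unique (fun j => t (j + 1)) (cf q (fun j => t (j + 1)) n)
      (fun k => (s 0)⁻¹ *
        ∑ m ∈ Finset.range (n + 1 + 1), if k ≤ m then s (m - k) * p (m + 1) else 0)
      n iK hcf (by
        intro j hj
        have h1 := aux_coreK t s p _ hA (n + 1) j
        rw [hpe (j + 1) (by omega), Finset.sum_eq_zero (s := Finset.range (j + 1)), sub_zero] at h1
        · exact h1
        · intro i hi
          rw [hpe (j - i) (by omega), mul_zero]) (by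
        rw [cf_top, Finset.sum_range_succ, Finset.sum_eq_zero, zero_add, if_pos le_rfl,
          Nat.sub_self, hp, cf_top, mul_one, h']
        intro m hm
        have := Finset.mem_range.mp hm
        rw [if_neg (by omega)])
    have h1 := aux_core t s (fun m => p (m + 1)) _ hA (n + 1) 0
    simp only [Finset.range_zero, Finset.sum_empty, sub_zero, zero_add] at h1
    have h2 := hpe 0 (by omega)
    rw [Finset.sum_range_succ'] at h2
    simp only [zero_add] at h2
    rw [← eq_neg_of_add_eq_zero_left h2, ← hp, ← h1]
    refine Finset.sum_congr rfl fun k hk => ?_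
    rw [key k (by have := Finset.mem_range.mp hk; omega)]

end
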